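/- arXiv:1208.3187 — 2 statements merged into one kernel-verified Lean document; each statement's English description precedes it below -/
import Mathlib

section
/- In the iidpnmrv setup with E^*[|X₁|] < ∞, let A be a non-empty proper subset of the interval [E_*[X₁], E^*[X₁]]. Then the set {ω ∈ Ω : lim_{n→∞} Sₙ(ω)/n exists and lies in A} is maximally nonmeasurable: every P-measurable subset of it has P-measure 0 and every P-measurable superset of it has P-measure 1. -/
open MeasureTheory Filter Topology

/-- `flow` is a maximal measurable minorant of `f` with respect to the measure `P`. -/
def IsMeasMinorant {Ω : Type*} [MeasurableSpace Ω] (P : Measure Ω) (f flow : Ω → ℝ) : Prop :=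
  Measurable flow ∧ (∀ ω, flow ω ≤ f ω) ∧
    ∀ g : Ω → ℝ, Measurable g → (∀ ω, g ω ≤ f ω) → ∀ᵐ ω ∂P, g ω ≤ flow ω

/-- `fup` is a minimal measurable majorant of `f` with respect to the measure `P`. -/
def IsMeasMajorant {Ω : Type*} [MeasurableSpace Ω] (P : Measure Ω) (f fup : Ω → ℝ) : Prop :=
  Measurable fup ∧ (∀ ω, f ω ≤ fup ω) ∧
    ∀ h : Ω → ℝ, Measurable h → (∀ ω, f ω ≤ h ω) → ∀ᵐ ω ∂P, fup ω ≤ h ω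

open ProbabilityTheory

/-- A set meeting every non-null measurable set carries a measure whose image under the inclusion is
the given measure. -/
lemma exists_measure_subtype_map_val {X : Type*} [MeasurableSpace X] (μ : Measure X) {D : Set X}
    (hD : ∀ s, MeasurableSet s → Disjoint s D → μ s = 0) :
    ∃ ν : Measure D, ν.map Subtype.val = μ := by
  have hle : (inferInstance : MeasurableSpace D) ≤
      (OuterMeasure.comap (Subtype.val : D → X) μ.toOuterMeasure).caratheodory := by
    rintro _ ⟨t, ht, rfl⟩
    rw [OuterMeasure.isCaratheodory_iff]
    intro u
    simp only [OuterMeasure.comap_apply, Measure.coe_toOuterMeasure]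
    rw [Set.image_inter_preimage, ← measure_inter_add_sdiff (Subtype.val '' u) ht,
      ← Set.image_sdiff_preimage]
  refine ⟨OuterMeasure.toMeasure _ hle, Measure.ext fun s hs => ?_⟩
  rw [Measure.map_apply measurable_subtype_coe hs,
    toMeasure_apply _ _ (measurable_subtype_coe hs), OuterMeasure.comap_apply,
    Measure.coe_toOuterMeasure, Subtype.image_preimage_coe]
  refine le_antisymm (measure_mono Set.inter_subset_right) ?_
  rw [← measure_toMeasurable (D ∩ s)]
  refine measure_mono_ae (ae_le_set.2 (hD _ (hs.diff (measurableSet_toMeasurable _ _)) ?_))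
  exact Set.disjoint_left.2 fun x hx hxD => hx.2 (subset_toMeasurable _ _ ⟨hxD, hx.1⟩)

/-- A product of sets of full outer measure has full outer measure. -/
lemma exists_mem_of_infinitePi_ne_zero {ι : Type*} {X : ι → Type*} [∀ i, MeasurableSpace (X i)]
    (μ : (i : ι) → Measure (X i)) [∀ i, IsProbabilityMeasure (μ i)] {D : (i : ι) → Set (X i)}
    (hD : ∀ i s, MeasurableSet s → Disjoint s (D i) → μ i s = 0)
    {C : Set ((i : ι) → X i)} (hC : MeasurableSet C) (hpos : Measure.infinitePi μ C ≠ 0) :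
    ∃ x ∈ C, ∀ i, x i ∈ D i := by
  choose ν hν using fun i => exists_measure_subtype_map_val (μ i) (hD i)
  have hprob (i : ι) : IsProbabilityMeasure (ν i) := by
    have h : IsProbabilityMeasure ((ν i).map Subtype.val) := by rw [hν]; infer_instance
    exact Measure.isProbabilityMeasure_of_map Subtype.val
  have hmap := Measure.infinitePi_map_pi ν (f := fun i => (Subtype.val : D i → X i))
    (fun i => measurable_subtype_coe)
  simp only [hν] at hmap
  rw [← hmap, Measure.map_apply (by fun_prop) hC] at hpos
  obtain ⟨y, hy⟩ := nonempty_of_measure_ne_zero hpos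
  exact ⟨_, hy, fun i => (y i).2⟩

lemma IsMeasMajorant.measure_eq_zero {Ω : Type*} [MeasurableSpace Ω] {P : Measure Ω}
    {f fup : Ω → ℝ} (h : IsMeasMajorant P f fup) {ε : ℝ} (hε : 0 < ε) {s : Set Ω}
    (hs : MeasurableSet s) (hf : ∀ x ∈ s, f x ≤ fup x - ε) : P s = 0 := by
  have key := h.2.2 (fun x => fup x - s.indicator (fun _ => ε) x)
    (h.1.sub (measurable_const.indicator hs)) (fun x => by
      by_cases hx : x ∈ s
      · simpa [hx] using hf x hx
      · simpa [hx] using h.2.1 x)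
  refine measure_mono_null (fun x hx => ?_) (ae_iff.1 key)
  simp [hx, hε]

lemma IsMeasMinorant.isMeasMajorant_neg {Ω : Type*} [MeasurableSpace Ω] {P : Measure Ω}
    {f flow : Ω → ℝ} (h : IsMeasMinorant P f flow) :
    IsMeasMajorant P (fun x => -f x) (fun x => -flow x) := by
  refine ⟨h.1.neg, fun x => neg_le_neg (h.2.1 x), fun g hg hfg => ?_⟩
  filter_upwards [h.2.2 (fun x => -g x) hg.neg fun x => by linarith [hfg x]] with x hx
  linarith

lemma IsMeasMajorant.integrable {Ω : Type*} [MeasurableSpace Ω] {P : Measure Ω}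
    {f fup fabs : Ω → ℝ} (h : IsMeasMajorant P f fup) (habs : IsMeasMajorant P (fun x => |f x|) fabs)
    (hint : Integrable fabs P) : Integrable fup P := by
  refine hint.mono' h.1.aestronglyMeasurable ?_
  filter_upwards [h.2.2 fabs habs.1 fun x => (le_abs_self _).trans (habs.2.1 x)] with x hx
  refine abs_le.2 ⟨?_, hx⟩
  linarith [h.2.1 x, neg_abs_le (f x), habs.2.1 x]

/-- The strong law of large numbers for coordinates of an infinite product. -/
lemma ae_tendsto_average_infinitePi {X : Type*} [MeasurableSpace X] (μ : Measure X)
    [IsProbabilityMeasure μ] {F : X → ℝ} (hF : Measurable F) (hint : Integrable F μ) :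
    ∀ᵐ w ∂Measure.infinitePi (fun _ : ℕ => μ),
      Tendsto (fun n : ℕ => (∑ i ∈ Finset.range n, F (w i)) / n) atTop (𝓝 (∫ x, F x ∂μ)) := by
  have hmp (i : ℕ) := measurePreserving_eval_infinitePi (fun _ : ℕ => μ) i
  have key := strong_law_ae_real (μ := Measure.infinitePi (fun _ : ℕ => μ))
    (fun i w => F (w i)) ((hmp 0).integrable_comp_of_integrable hint)
    (fun i j hij => (iIndepFun_infinitePi (P := fun _ : ℕ => μ) (X := fun _ => F)
      fun _ => hF).indepFun hij)
    (fun i => by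
      have h : IdentDistrib (Function.eval i) (Function.eval 0)
          (Measure.infinitePi (fun _ : ℕ => μ)) (Measure.infinitePi (fun _ : ℕ => μ)) :=
        ⟨(hmp i).measurable.aemeasurable, (hmp 0).measurable.aemeasurable,
          (hmp i).map_eq.trans (hmp 0).map_eq.symm⟩
      exact h.comp hF)
  have hE : ∫ w, F (w 0) ∂Measure.infinitePi (fun _ : ℕ => μ) = ∫ x, F x ∂μ := by
    conv_rhs => rw [← (hmp 0).map_eq]
    rw [integral_map (hmp 0).measurable.aemeasurable hF.aestronglyMeasurable]
  rwa [hE] at key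

/-- Averages of two sequences with vanishing difference have the same limit. -/
lemma tendsto_average_of_abs_sub_le {u v : ℕ → ℝ} {l : ℝ}
    (hu : Tendsto (fun n : ℕ => (∑ i ∈ Finset.range n, u i) / n) atTop (𝓝 l))
    (huv : ∀ i, |v i - u i| ≤ 1 / ((i : ℝ) + 1)) :
    Tendsto (fun n : ℕ => (∑ i ∈ Finset.range n, v i) / n) atTop (𝓝 l) := by
  have h0 : Tendsto (fun i => v i - u i) atTop (𝓝 0) :=
    squeeze_zero_norm huv tendsto_one_div_add_atTop_nhds_zero_nat
  have := hu.add h0.cesaro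
  rw [add_zero] at this
  refine this.congr fun n => ?_
  rw [Finset.sum_sub_distrib]
  ring

/-- Every value between the lower and the upper expectation is the limit of the averages
somewhere on each non-null measurable set. -/
lemma exists_mem_tendsto_average {Ω₁ : Type*} [MeasurableSpace Ω₁] (P₁ : Measure Ω₁)
    [IsProbabilityMeasure P₁] {Ψ Ψlow Ψup Ψabs : Ω₁ → ℝ}
    (hΨlow : IsMeasMinorant P₁ Ψ Ψlow) (hΨup : IsMeasMajorant P₁ Ψ Ψup)
    (hΨabs : IsMeasMajorant P₁ (fun x => |Ψ x|) Ψabs) (hInt : Integrable Ψabs P₁) {l : ℝ}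
    (hl : l ∈ Set.Icc (∫ x, Ψlow x ∂P₁) (∫ x, Ψup x ∂P₁)) {C : Set (ℕ → Ω₁)}
    (hC : MeasurableSet C) (hpos : Measure.infinitePi (fun _ : ℕ => P₁) C ≠ 0) :
    ∃ ω ∈ C, Tendsto (fun n : ℕ => (∑ i ∈ Finset.range n, Ψ (ω i)) / n) atTop (𝓝 l) := by
  have hintup : Integrable Ψup P₁ := hΨup.integrable hΨabs hInt
  have hintlow : Integrable Ψlow P₁ := by
    have h := hΨlow.isMeasMajorant_neg.integrable (by simpa only [abs_neg] using hΨabs) hInt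
    simpa using h.neg
  rw [← segment_eq_Icc (hl.1.trans hl.2)] at hl
  obtain ⟨a, b, ha, hb, hab, rfl⟩ := hl
  let ρ : Measure (Ω₁ × Bool) :=
    ENNReal.ofReal a • P₁.map (fun x => (x, false)) + ENNReal.ofReal b • P₁.map (fun x => (x, true))
  have hm (c : Bool) : Measurable (fun x : Ω₁ => (x, c)) := measurable_prodMk_right
  have hfst : ρ.map Prod.fst = P₁ := by
    simp only [ρ]
    rw [Measure.map_add _ _ measurable_fst, Measure.map_smul, Measure.map_smul,
      Measure.map_map measurable_fst (hm _), Measure.map_map measurable_fst (hm _)]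
    simp only [Function.comp_def, Measure.map_id']
    rw [← add_smul, ← ENNReal.ofReal_add ha hb, hab, ENNReal.ofReal_one, one_smul]
  have hρ : IsProbabilityMeasure ρ := by
    have h : IsProbabilityMeasure (ρ.map Prod.fst) := by rw [hfst]; infer_instance
    exact Measure.isProbabilityMeasure_of_map Prod.fst
  let F : Ω₁ × Bool → ℝ := fun p => if p.2 = true then Ψup p.1 else Ψlow p.1
  have hF : Measurable F :=
    Measurable.ite (measurable_snd (measurableSet_singleton true))
      (hΨup.1.comp measurable_fst) (hΨlow.1.comp measurable_fst)
  have hF0 : Integrable F (P₁.map (fun x => (x, false))) := by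
    rw [integrable_map_measure hF.aestronglyMeasurable (hm _).aemeasurable]
    simpa [F, Function.comp_def] using hintlow
  have hF1 : Integrable F (P₁.map (fun x => (x, true))) := by
    rw [integrable_map_measure hF.aestronglyMeasurable (hm _).aemeasurable]
    simpa [F, Function.comp_def] using hintup
  have hF0' := hF0.smul_measure (ENNReal.ofReal_ne_top (r := a))
  have hF1' := hF1.smul_measure (ENNReal.ofReal_ne_top (r := b))
  have hE : ∫ p, F p ∂ρ = a • ∫ x, Ψlow x ∂P₁ + b • ∫ x, Ψup x ∂P₁ := by
    simp only [ρ]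
    rw [integral_add_measure hF0' hF1', integral_smul_measure, integral_smul_measure,
      integral_map (hm _).aemeasurable hF.aestronglyMeasurable,
      integral_map (hm _).aemeasurable hF.aestronglyMeasurable,
      ENNReal.toReal_ofReal ha, ENNReal.toReal_ofReal hb]
    simp [F]
  have hlim := ae_tendsto_average_infinitePi ρ hF (hF0'.add_measure hF1')
  rw [hE] at hlim
  obtain ⟨N, hN, hNm, hN0⟩ := exists_measurable_superset_of_null (ae_iff.1 hlim)
  have hmap : (Measure.infinitePi (fun _ : ℕ => ρ)).map (fun w i => (w i).1) =
      Measure.infinitePi (fun _ : ℕ => P₁) := by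
    rw [Measure.infinitePi_map_pi (fun _ : ℕ => ρ) (f := fun _ => Prod.fst)
      (fun _ => measurable_fst)]
    simp only [hfst]
  have hpm : Measurable (fun (w : ℕ → Ω₁ × Bool) i => (w i).1) := by fun_prop
  rw [← hmap, Measure.map_apply hpm hC, ← measure_sdiff_null hN0] at hpos
  obtain ⟨w, hw, hwD⟩ := exists_mem_of_infinitePi_ne_zero (fun _ : ℕ => ρ)
    (D := fun i => {p | |Ψ p.1 - F p| ≤ 1 / ((i : ℝ) + 1)}) (fun i s hs hdis => by
      have hε : (0 : ℝ) < 1 / ((i : ℝ) + 1) := by positivity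
      have hbad (p) (hp : p ∈ s) : 1 / ((i : ℝ) + 1) < |Ψ p.1 - F p| :=
        not_le.1 fun h => Set.disjoint_left.1 hdis hp h
      have h0 : P₁ ((fun x => (x, false)) ⁻¹' s) = 0 :=
        hΨlow.isMeasMajorant_neg.measure_eq_zero hε (hm _ hs) fun x hx => by
          have h := hbad _ hx
          simp only [F, Bool.false_eq_true, if_false] at h
          rw [abs_of_nonneg (sub_nonneg.2 (hΨlow.2.1 x))] at h
          linarith
      have h1 : P₁ ((fun x => (x, true)) ⁻¹' s) = 0 :=
        hΨup.measure_eq_zero hε (hm _ hs) fun x hx => by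
          have h := hbad _ hx
          simp only [F, if_true] at h
          rw [abs_of_nonpos (sub_nonpos.2 (hΨup.2.1 x))] at h
          linarith
      simp [ρ, Measure.map_apply (hm _) hs, h0, h1])
    ((hpm hC).diff hNm) hpos
  refine ⟨fun i => (w i).1, hw.1, tendsto_average_of_abs_sub_le (u := fun i => F (w i)) ?_ hwD⟩
  exact not_not.1 fun h => hw.2 (hN h)

/-- In the iidpnmrv setup with integrable minimal measurable majorant of `|Ψ|`, for any nonempty proper subset `A` of `[E_*[X₁], E^*[X₁]]`, the set where `lim Sₙ/n` exists and lies in `A` is maximally nonmeasurable. -/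
theorem lim_mem_maximally_nonmeasurable
    {Ω₁ : Type*} [MeasurableSpace Ω₁] (P₁ : Measure Ω₁) [IsProbabilityMeasure P₁]
    (P : Measure (ℕ → Ω₁)) [IsProbabilityMeasure P]
    (hP : IsProjectiveLimit P (fun J : Finset ℕ => Measure.pi (fun _ : J => P₁)))
    (Ψ Ψlow Ψup Ψabs : Ω₁ → ℝ)
    (hΨlow : IsMeasMinorant P₁ Ψ Ψlow)
    (hΨup : IsMeasMajorant P₁ Ψ Ψup)
    (hΨabs : IsMeasMajorant P₁ (fun x => |Ψ x|) Ψabs)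
    (hInt : Integrable Ψabs P₁)
    (A : Set ℝ) (hA₁ : A.Nonempty)
    (hA₂ : A ⊆ Set.Icc (∫ x, Ψlow x ∂P₁) (∫ x, Ψup x ∂P₁))
    (hA₃ : A ≠ Set.Icc (∫ x, Ψlow x ∂P₁) (∫ x, Ψup x ∂P₁)) :
    (∀ B : Set (ℕ → Ω₁), MeasurableSet B →
        B ⊆ {ω : ℕ → Ω₁ | ∃ l ∈ A, Tendsto (fun n : ℕ => (∑ i ∈ Finset.range n, Ψ (ω i)) / n) atTop (𝓝 l)} → P B = 0) ∧
    (∀ B : Set (ℕ → Ω₁), MeasurableSet B →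
        {ω : ℕ → Ω₁ | ∃ l ∈ A, Tendsto (fun n : ℕ => (∑ i ∈ Finset.range n, Ψ (ω i)) / n) atTop (𝓝 l)} ⊆ B → P B = 1) := by
  have hPeq : P = Measure.infinitePi (fun _ : ℕ => P₁) :=
    hP.unique (Measure.isProjectiveLimit_infinitePi _)
  have hnull {l : ℝ} (hl : l ∈ Set.Icc (∫ x, Ψlow x ∂P₁) (∫ x, Ψup x ∂P₁)) {C : Set (ℕ → Ω₁)}
      (hC : MeasurableSet C) (hdis : ∀ ω ∈ C,
        ¬ Tendsto (fun n : ℕ => (∑ i ∈ Finset.range n, Ψ (ω i)) / n) atTop (𝓝 l)) : P C = 0 := by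
    by_contra hpos
    rw [hPeq] at hpos
    obtain ⟨ω, hω, hlim⟩ :=
      exists_mem_tendsto_average P₁ hΨlow hΨup hΨabs hInt hl hC hpos
    exact hdis ω hω hlim
  refine ⟨fun B hB hsub => ?_, fun B hB hsup => ?_⟩
  · obtain ⟨b, hb, hbA⟩ := Set.exists_of_ssubset (hA₂.ssubset_of_ne hA₃)
    refine hnull hb hB fun ω hω hlim => ?_
    obtain ⟨l, hlA, hl⟩ := hsub hω
    exact hbA (tendsto_nhds_unique hl hlim ▸ hlA)
  · obtain ⟨a, ha⟩ := hA₁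
    rw [← prob_compl_eq_zero_iff hB]
    exact hnull (hA₂ ha) hB.compl fun ω hω hlim => hω (hsup ⟨a, ha, hlim⟩)
end

section
/- In the iidpnmrv setup with E^*[|X₁|] < ∞, let A be a non-empty proper subset of the interval [E_*[X₁], E^*[X₁]]. Then the set {ω ∈ Ω : every limit point of the sequence (Sₙ(ω)/n) lies in A} is maximally nonmeasurable: every P-measurable subset of it has P-measure 0 and every P-measurable superset of it has P-measure 1. -/
open MeasureTheory Filter Topology

/-- A subset of full outer measure carries a measure on its trace σ-algebra that pushes forward to
the original measure, even if the subset is not measurable. -/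
lemma exists_measure_map_subtype_val_eq {X : Type*} [MeasurableSpace X] (μ : Measure X)
    [IsProbabilityMeasure μ] {E : Set X} (hE : μ E = 1) :
    ∃ ν : Measure E, ν.map Subtype.val = μ := by
  have hcar : (inferInstance : MeasurableSpace E) ≤
      (OuterMeasure.comap (Subtype.val : E → X) μ.toOuterMeasure).caratheodory := by
    rintro _ ⟨T, hT, rfl⟩
    refine (OuterMeasure.isCaratheodory_iff_le _).2 fun s => ?_
    simp only [OuterMeasure.comap_apply, Measure.coe_toOuterMeasure]
    rw [← measure_inter_add_sdiff (Subtype.val '' s) hT]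
    refine add_le_add (measure_mono ?_) (measure_mono ?_)
    · rintro _ ⟨x, ⟨hx, hxT⟩, rfl⟩
      exact ⟨⟨x, hx, rfl⟩, hxT⟩
    · rintro _ ⟨x, ⟨hx, hxT⟩, rfl⟩
      exact ⟨⟨x, hx, rfl⟩, hxT⟩
  refine ⟨OuterMeasure.toMeasure _ hcar, Measure.ext fun T hT => ?_⟩
  rw [Measure.map_apply measurable_subtype_coe hT,
    toMeasure_apply _ _ (measurable_subtype_coe hT), OuterMeasure.comap_apply,
    Measure.coe_toOuterMeasure, Subtype.image_preimage_coe,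
    ← Measure.measure_toMeasurable_inter hT (measure_ne_top μ E), Set.inter_comm]
  refine measure_inter_conull' ?_
  refine measure_mono_null (Set.sdiff_subset_compl _ _) ?_
  rw [prob_compl_eq_zero_iff (measurableSet_toMeasurable μ E), measure_toMeasurable, hE]

/-- A countable product of sets of full outer measure has full outer measure. -/
lemma infinitePi_univ_pi_eq_one {X : Type*} [MeasurableSpace X] (μ : Measure X)
    [IsProbabilityMeasure μ] {E : ℕ → Set X} (hE : ∀ n, μ (E n) = 1) :
    Measure.infinitePi (fun _ : ℕ => μ) (Set.univ.pi E) = 1 := by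
  choose ν hν using fun n => exists_measure_map_subtype_val_eq μ (hE n)
  have hprob (n : ℕ) : IsProbabilityMeasure (ν n) := by
    constructor
    rw [← Set.preimage_univ (f := (Subtype.val : E n → X)),
      ← Measure.map_apply measurable_subtype_coe .univ, hν n, measure_univ]
  have hmap := Measure.infinitePi_map_pi ν (f := fun n => (Subtype.val : E n → X))
    fun n => measurable_subtype_coe
  simp only [hν] at hmap
  refine le_antisymm prob_le_one ?_
  rw [← hmap]
  refine le_trans ?_ (Measure.le_map_apply (Measurable.aemeasurable <|
    measurable_pi_lambda _ fun n => measurable_subtype_coe.comp (measurable_pi_apply n)) _)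
  rw [← measure_univ (μ := Measure.infinitePi ν)]
  exact measure_mono fun x _ n _ => (x n).2

lemma IsMeasMajorant.measure_sub_lt_eq_one {X : Type*} [MeasurableSpace X] {μ : Measure X}
    [IsProbabilityMeasure μ] {f fup : X → ℝ} (h : IsMeasMajorant μ f fup) {ε : ℝ} (hε : 0 < ε) :
    μ {x | fup x - ε < f x} = 1 := by
  classical
  set E := {x | fup x - ε < f x}
  set C := toMeasurable μ E
  have hC : MeasurableSet C := measurableSet_toMeasurable μ E
  have hle := h.2.2 (C.piecewise fup fun x => fup x - ε)
    (h.1.piecewise hC (h.1.sub_const ε)) fun x => by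
      by_cases hx : x ∈ C
      · simpa [hx] using h.2.1 x
      · have hxE : x ∉ E := fun hx' => hx (subset_toMeasurable μ E hx')
        simpa [hx, E] using hxE
  rw [← measure_toMeasurable E, ← prob_compl_eq_zero_iff hC]
  refine measure_mono_null (fun x hx => ?_) hle
  have hx' : x ∉ C := hx
  simp [hx', hε]

lemma IsMeasMinorant.neg {X : Type*} [MeasurableSpace X] {μ : Measure X} {f flow : X → ℝ}
    (h : IsMeasMinorant μ f flow) : IsMeasMajorant μ (-f) (-flow) := by
  refine ⟨h.1.neg, fun x => neg_le_neg (h.2.1 x), fun g hg hfg => ?_⟩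
  filter_upwards [h.2.2 (-g) hg.neg fun x => neg_le.1 (hfg x)] with x hx
  exact neg_le.1 hx

lemma IsMeasMajorant.integrable_s8 {X : Type*} [MeasurableSpace X] {μ : Measure X}
    {f fup g : X → ℝ} (h : IsMeasMajorant μ f fup) (hg : Measurable g)
    (hfg : ∀ x, |f x| ≤ g x) (hint : Integrable g μ) : Integrable fup μ := by
  refine hint.mono' h.1.aestronglyMeasurable ?_
  filter_upwards [h.2.2 g hg fun x => (le_abs_self _).trans (hfg x)] with x hx
  exact abs_le.2 ⟨(neg_le_of_abs_le (hfg x)).trans (h.2.1 x), hx⟩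

/-- If a measurable `Y` approximates `f ∘ φ` arbitrarily well on sets of full outer measure, then
the averages of `f` along i.i.d. samples converge to the mean of `Y` with full outer measure. -/
lemma infinitePi_map_average_tendsto_eq_one {X Z : Type*} [MeasurableSpace X] [MeasurableSpace Z]
    (ν : Measure Z) [IsProbabilityMeasure ν] {φ : Z → X} (hφ : Measurable φ) {f : X → ℝ}
    {Y : Z → ℝ} (hY : Measurable Y) (hYint : Integrable Y ν)
    (happrox : ∀ ε > 0, ν {z | |f (φ z) - Y z| < ε} = 1) :
    Measure.infinitePi (fun _ : ℕ => ν.map φ)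
      {ω | Tendsto (fun n : ℕ => (∑ i ∈ Finset.range n, f (ω i)) / n) atTop
        (𝓝 (∫ z, Y z ∂ν))} = 1 := by
  set Q := Measure.infinitePi (fun _ : ℕ => ν)
  have heval (i : ℕ) : Measurable fun z : ℕ → Z => z i := measurable_pi_apply i
  have hpres (i : ℕ) : MeasurePreserving (fun z : ℕ → Z => z i) Q ν :=
    measurePreserving_eval_infinitePi (fun _ => ν) i
  have hslln : ∀ᵐ z ∂Q, Tendsto (fun n : ℕ => (∑ i ∈ Finset.range n, Y (z i)) / n) atTop
      (𝓝 (∫ z, Y z ∂ν)) := by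
    have hmean : ∫ z, Y (z 0) ∂Q = ∫ z, Y z ∂ν := by
      conv_rhs => rw [← (hpres 0).map_eq]
      exact (integral_map (heval 0).aemeasurable hY.aestronglyMeasurable).symm
    have hindep : ProbabilityTheory.iIndepFun (fun (i : ℕ) (z : ℕ → Z) => Y (z i)) Q :=
      ProbabilityTheory.iIndepFun_infinitePi (P := fun _ : ℕ => ν) (X := fun _ => Y) fun _ => hY
    have hid (i : ℕ) : ProbabilityTheory.IdentDistrib (fun z : ℕ → Z => Y (z i))
        (fun z => Y (z 0)) Q Q :=
      ProbabilityTheory.IdentDistrib.comp (u := Y) ⟨(heval i).aemeasurable,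
        (heval 0).aemeasurable, (hpres i).map_eq.trans (hpres 0).map_eq.symm⟩ hY
    have hint : Integrable (fun z : ℕ → Z => Y (z 0)) Q :=
      (hpres 0).integrable_comp_of_integrable hYint
    have hlaw := ProbabilityTheory.strong_law_ae_real (μ := Q) (fun i z => Y (z i)) hint
      (fun i j hij => hindep.indepFun hij) hid
    rwa [hmean] at hlaw
  have hprod : Q (Set.univ.pi fun n : ℕ => {z | |f (φ z) - Y z| < 1 / ((n : ℝ) + 1)}) = 1 :=
    infinitePi_univ_pi_eq_one ν fun n => happrox _ (by positivity)
  have hmap := Measure.infinitePi_map_pi (fun _ : ℕ => ν) (f := fun _ => φ) fun _ => hφ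
  have hφpi : Measurable fun (z : ℕ → Z) n => φ (z n) :=
    measurable_pi_lambda _ fun n => hφ.comp (measurable_pi_apply n)
  have hprob : IsProbabilityMeasure (ν.map φ) := Measure.isProbabilityMeasure_map hφ.aemeasurable
  refine le_antisymm prob_le_one ?_
  rw [← hmap, ← hprod]
  refine le_trans (measure_mono_ae ?_) (Measure.le_map_apply hφpi.aemeasurable _)
  filter_upwards [hslln] with z hz hzE
  have herr : Tendsto (fun n => f (φ (z n)) - Y (z n)) atTop (𝓝 0) :=
    squeeze_zero_norm (fun n => (hzE n trivial).le) tendsto_one_div_add_atTop_nhds_zero_nat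
  have hsum := herr.cesaro.add hz
  rw [zero_add] at hsum
  refine hsum.congr fun n => ?_
  rw [Finset.sum_sub_distrib]
  ring

/-- Every point between the lower and the upper mean is the limit of the averages of i.i.d. copies
of a possibly nonmeasurable function with full outer measure. -/
lemma infinitePi_average_tendsto_eq_one {X : Type*} [MeasurableSpace X] (μ : Measure X)
    [IsProbabilityMeasure μ] {f flow fup : X → ℝ} (hlow : IsMeasMinorant μ f flow)
    (hup : IsMeasMajorant μ f fup) (hlow_int : Integrable flow μ) (hup_int : Integrable fup μ)
    {c : ℝ} (hc : c ∈ Set.Icc (∫ x, flow x ∂μ) (∫ x, fup x ∂μ)) :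
    Measure.infinitePi (fun _ : ℕ => μ)
      {ω | Tendsto (fun n : ℕ => (∑ i ∈ Finset.range n, f (ω i)) / n) atTop (𝓝 c)} = 1 := by
  rw [← segment_eq_Icc (hc.1.trans hc.2)] at hc
  obtain ⟨s, t, hs, ht, hst, rfl⟩ := hc
  have hst' : ENNReal.ofReal s + ENNReal.ofReal t = 1 := by
    rw [← ENNReal.ofReal_add hs ht, hst, ENNReal.ofReal_one]
  have hinl : Measurable (Sum.inl : X → X ⊕ X) := measurable_inl
  have hinr : Measurable (Sum.inr : X → X ⊕ X) := measurable_inr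
  set ν : Measure (X ⊕ X) :=
    ENNReal.ofReal s • μ.map Sum.inl + ENNReal.ofReal t • μ.map Sum.inr with hν
  have hle (S : Set (X ⊕ X)) (hl : μ (Sum.inl ⁻¹' S) = 1) (hr : μ (Sum.inr ⁻¹' S) = 1) :
      1 ≤ ν S := by
    rw [hν, Measure.add_apply, Measure.smul_apply, Measure.smul_apply, smul_eq_mul, smul_eq_mul]
    calc (1 : ENNReal) = ENNReal.ofReal s * 1 + ENNReal.ofReal t * 1 := by simp [hst']
      _ ≤ _ := by
        gcongr
        · exact hl ▸ Measure.le_map_apply hinl.aemeasurable S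
        · exact hr ▸ Measure.le_map_apply hinr.aemeasurable S
  have hprob : IsProbabilityMeasure ν := by
    constructor
    simp [hν, Measure.map_apply hinl, Measure.map_apply hinr, hst']
  have hφ : Measurable (Sum.elim id id : X ⊕ X → X) := measurable_id.sumElim measurable_id
  have hY : Measurable (Sum.elim flow fup) := hlow.1.sumElim hup.1
  have hYl : Integrable (Sum.elim flow fup) (ENNReal.ofReal s • μ.map Sum.inl) :=
    Integrable.smul_measure ((integrable_map_measure hY.aestronglyMeasurable
      hinl.aemeasurable).2 hlow_int) ENNReal.ofReal_ne_top
  have hYr : Integrable (Sum.elim flow fup) (ENNReal.ofReal t • μ.map Sum.inr) :=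
    Integrable.smul_measure ((integrable_map_measure hY.aestronglyMeasurable
      hinr.aemeasurable).2 hup_int) ENNReal.ofReal_ne_top
  have hmap : ν.map (Sum.elim id id) = μ := by
    rw [hν, Measure.map_add _ _ hφ, Measure.map_smul, Measure.map_smul,
      Measure.map_map hφ hinl, Measure.map_map hφ hinr, Sum.elim_comp_inl, Sum.elim_comp_inr,
      Measure.map_id, ← add_smul, hst', one_smul]
  have hmean : ∫ z, Sum.elim flow fup z ∂ν = s • (∫ x, flow x ∂μ) + t • ∫ x, fup x ∂μ := by
    rw [hν, integral_add_measure hYl hYr, integral_smul_measure, integral_smul_measure,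
      integral_map hinl.aemeasurable hY.aestronglyMeasurable,
      integral_map hinr.aemeasurable hY.aestronglyMeasurable,
      ENNReal.toReal_ofReal hs, ENNReal.toReal_ofReal ht]
    rfl
  have key := infinitePi_map_average_tendsto_eq_one ν hφ (f := f) hY (hYl.add_measure hYr)
    fun ε hε => le_antisymm prob_le_one <| hle _ ?_ ?_
  · simpa only [hmap, hmean] using key
  · rw [← hlow.neg.measure_sub_lt_eq_one hε]
    congr 1
    ext x
    have := hlow.2.1 x
    simp only [Set.mem_preimage, Set.mem_ofPred_eq, Sum.elim_inl, id, Pi.neg_apply]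
    rw [abs_of_nonneg (by linarith)]
    constructor <;> intro <;> linarith
  · rw [← hup.measure_sub_lt_eq_one hε]
    congr 1
    ext x
    have := hup.2.1 x
    simp only [Set.mem_preimage, Set.mem_ofPred_eq, Sum.elim_inr, id]
    rw [abs_of_nonpos (by linarith)]
    constructor <;> intro <;> linarith

/-- In the iidpnmrv setup with integrable minimal measurable majorant of `|Ψ|`, for any nonempty proper subset `A` of `[E_*[X₁], E^*[X₁]]`, the set where all limit points of `Sₙ/n` lie in `A` is maximally nonmeasurable. -/
theorem limit_points_maximally_nonmeasurable
    {Ω₁ : Type*} [MeasurableSpace Ω₁] (P₁ : Measure Ω₁) [IsProbabilityMeasure P₁]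
    (P : Measure (ℕ → Ω₁)) [IsProbabilityMeasure P]
    (hP : IsProjectiveLimit P (fun J : Finset ℕ => Measure.pi (fun _ : J => P₁)))
    (Ψ Ψlow Ψup Ψabs : Ω₁ → ℝ)
    (hΨlow : IsMeasMinorant P₁ Ψ Ψlow)
    (hΨup : IsMeasMajorant P₁ Ψ Ψup)
    (hΨabs : IsMeasMajorant P₁ (fun x => |Ψ x|) Ψabs)
    (hInt : Integrable Ψabs P₁)
    (A : Set ℝ) (hA₁ : A.Nonempty)
    (hA₂ : A ⊆ Set.Icc (∫ x, Ψlow x ∂P₁) (∫ x, Ψup x ∂P₁))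
    (hA₃ : A ≠ Set.Icc (∫ x, Ψlow x ∂P₁) (∫ x, Ψup x ∂P₁)) :
    (∀ B : Set (ℕ → Ω₁), MeasurableSet B →
        B ⊆ {ω : ℕ → Ω₁ | ∀ l : ℝ, MapClusterPt l atTop (fun n : ℕ => (∑ i ∈ Finset.range n, Ψ (ω i)) / n) → l ∈ A} → P B = 0) ∧
    (∀ B : Set (ℕ → Ω₁), MeasurableSet B →
        {ω : ℕ → Ω₁ | ∀ l : ℝ, MapClusterPt l atTop (fun n : ℕ => (∑ i ∈ Finset.range n, Ψ (ω i)) / n) → l ∈ A} ⊆ B → P B = 1) := by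
  have hPeq : P = Measure.infinitePi (fun _ : ℕ => P₁) :=
    hP.unique (Measure.isProjectiveLimit_infinitePi _)
  have hup_int : Integrable Ψup P₁ := hΨup.integrable_s8 hΨabs.1 hΨabs.2.1 hInt
  have hlow_int : Integrable Ψlow P₁ := integrable_neg_iff.1 <|
    hΨlow.neg.integrable_s8 hΨabs.1 (fun x => (abs_neg (Ψ x)).trans_le (hΨabs.2.1 x)) hInt
  have hlim {c : ℝ} (hc : c ∈ Set.Icc (∫ x, Ψlow x ∂P₁) (∫ x, Ψup x ∂P₁)) :=
    infinitePi_average_tendsto_eq_one P₁ hΨlow hΨup hlow_int hup_int hc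
  rw [← hPeq] at hlim
  constructor
  · intro B hB hBsub
    obtain ⟨d, hd, hdA⟩ := Set.exists_of_ssubset (hA₂.ssubset_of_ne hA₃)
    rw [← prob_compl_eq_one_iff hB]
    refine le_antisymm prob_le_one ((hlim hd).ge.trans (measure_mono fun ω hω hωB => ?_))
    exact hdA (hBsub hωB d (Tendsto.mapClusterPt hω))
  · intro B hB hBsup
    obtain ⟨c, hc⟩ := hA₁
    refine le_antisymm prob_le_one ((hlim (hA₂ hc)).ge.trans (measure_mono fun ω hω => ?_))
    refine hBsup fun l hl => ?_
    rwa [eq_of_nhds_neBot (hl.neBot.mono (inf_le_inf_left _ hω))]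
end
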